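/- arXiv:0912.5467 — 2 statements merged into one kernel-verified Lean document; each statement's English description precedes it below -/
import Mathlib

section
/- Let A_1,…,A_s be real l×m matrices and let c ∈ ℝ^m be nonzero with c in the range of Σ_{i=1}^s A_i^T A_i. Then the supremum of c^T X c over {X ∈ ℝ^{m×m} symmetric : X positive semidefinite, trace(A_i X A_i^T) ≤ 1 for all i ∈ {1,…,s}} equals the infimum of Σ_{i=1}^s μ_i over {μ ∈ ℝ^s : μ ≥ 0 and Σ_{i=1}^s μ_i A_i^T A_i − c c^T is positive semidefinite}, and both are attained. Moreover, if μ* attains the infimum, then w := μ*/(Σ_i μ_i*) is a c-optimal design and V_c(w) = Σ_i μ_i*. -/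
open Matrix BigOperators

/-- Information matrix `M(w) = ∑ i, w i • A iᵀ A i` for multiresponse experiments. -/
noncomputable def infoMat {s l m : ℕ} (A : Fin s → Matrix (Fin l) (Fin m) ℝ)
    (w : Fin s → ℝ) : Matrix (Fin m) (Fin m) ℝ :=
  ∑ i, w i • ((A i)ᵀ * A i)

/-- A design: nonnegative weights summing to one. -/
def IsDesign {s : ℕ} (w : Fin s → ℝ) : Prop :=
  (∀ i, 0 ≤ w i) ∧ ∑ i, w i = 1

/-- `w` is feasible for `c` when `c` lies in the range of `M(w)`. -/
def FeasibleFor {s l m : ℕ} (A : Fin s → Matrix (Fin l) (Fin m) ℝ) (c : Fin m → ℝ)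
    (w : Fin s → ℝ) : Prop :=
  ∃ u, infoMat A w *ᵥ u = c

/-- `w` is a `c`-optimal design. -/
def IsCOptimal {s l m : ℕ} (A : Fin s → Matrix (Fin l) (Fin m) ℝ) (c : Fin m → ℝ)
    (w : Fin s → ℝ) : Prop :=
  IsDesign w ∧ FeasibleFor A c w ∧
    ∀ (w' : Fin s → ℝ) (u u' : Fin m → ℝ), IsDesign w' →
      infoMat A w *ᵥ u = c → infoMat A w' *ᵥ u' = c →
        c ⬝ᵥ u ≤ c ⬝ᵥ u'

/-- Feasibility for the primal SDP: `X` symmetric positive semidefinite with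
`trace (A i X A iᵀ) ≤ 1` for all `i`. -/
def PrimalSDPFeas {s l m : ℕ} (A : Fin s → Matrix (Fin l) (Fin m) ℝ)
    (X : Matrix (Fin m) (Fin m) ℝ) : Prop :=
  X.PosSemidef ∧ ∀ i, Matrix.trace (A i * X * (A i)ᵀ) ≤ 1

/-- Feasibility for the dual SDP: `μ ≥ 0` and `∑ i, μ i • A iᵀ A i ⪰ c cᵀ`. -/
def DualSDPFeas {s l m : ℕ} (A : Fin s → Matrix (Fin l) (Fin m) ℝ) (c : Fin m → ℝ)
    (μ : Fin s → ℝ) : Prop :=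
  (∀ i, 0 ≤ μ i) ∧
  ((∑ i, μ i • ((A i)ᵀ * A i)) - Matrix.vecMulVec c c).PosSemidef

/-- A linear functional vanishing on the kernel of a linear map into `ℝ^m` factors through that
map as a dot product. -/
lemma exists_dotProduct_eq_of_ker_le {E : Type*} [AddCommGroup E] [Module ℝ E] {m : ℕ}
    (T : E →ₗ[ℝ] (Fin m → ℝ)) (f : E →ₗ[ℝ] ℝ) (h : ∀ z, T z = 0 → f z = 0) :
    ∃ x : Fin m → ℝ, ∀ z, f z = x ⬝ᵥ T z := by
  have hf : f ∈ LinearMap.range T.dualMap := by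
    rw [LinearMap.range_dualMap_eq_dualAnnihilator_ker, Submodule.mem_dualAnnihilator]
    exact fun z hz => h z hz
  obtain ⟨φ, rfl⟩ := hf
  refine ⟨fun j => φ (Pi.single j 1), fun z => ?_⟩
  rw [LinearMap.dualMap_apply, LinearMap.pi_apply_eq_sum_univ φ (T z)]
  refine Finset.sum_congr rfl fun j _ => ?_
  rw [smul_eq_mul, mul_comm]
  congr 2
  ext k
  simp [Pi.single_apply, eq_comm]

/-- Norm duality for linear maps on a finite-dimensional normed space: a minimal-norm preimage
together with a certificate of its minimality. -/
lemma exists_map_eq_and_dotProduct_eq_norm {E : Type*} [NormedAddCommGroup E] [NormedSpace ℝ E]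
    [FiniteDimensional ℝ E] {m : ℕ} (T : E →ₗ[ℝ] (Fin m → ℝ)) (z₀ : E) :
    ∃ (z : E) (x : Fin m → ℝ), T z = T z₀ ∧ x ⬝ᵥ T z₀ = ‖z‖ ∧ ∀ v, x ⬝ᵥ T v ≤ ‖v‖ := by
  let K := LinearMap.ker T
  have : ProperSpace E := FiniteDimensional.proper ℝ E
  have hK : IsClosed (K : Set E) := K.closed_of_finiteDimensional
  obtain ⟨k, hk, hdist⟩ := hK.exists_infDist_eq_dist ⟨0, K.zero_mem⟩ z₀
  obtain ⟨g, hg1, hg⟩ := exists_dual_vector'' ℝ (K.mkQ z₀)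
  have hnorm : ‖K.mkQ z₀‖ = ‖z₀ - k‖ := by
    rw [← dist_eq_norm, ← hdist]
    exact QuotientAddGroup.norm_mk z₀
  obtain ⟨x, hx⟩ := exists_dotProduct_eq_of_ker_le T ((g : _ →ₗ[ℝ] ℝ) ∘ₗ K.mkQ) fun z hz => by
    have : K.mkQ z = 0 := (Submodule.Quotient.mk_eq_zero K).2 hz
    rw [LinearMap.comp_apply, this, map_zero]
  refine ⟨z₀ - k, x, ?_, ?_, fun v => ?_⟩
  · rw [map_sub, show T k = 0 from hk, sub_zero]
  · rw [← hx, ← hnorm]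
    exact hg
  · rw [← hx]
    refine (le_abs_self _).trans ((g.le_of_opNorm_le hg1 _).trans ?_)
    rw [one_mul]
    exact Submodule.Quotient.norm_mk_le K v

/-- The trace of a product of two real positive semidefinite matrices is nonnegative. -/
lemma Matrix.PosSemidef.trace_mul_nonneg_real {n : Type*} [Fintype n] {P X : Matrix n n ℝ}
    (hP : P.PosSemidef) (hX : X.PosSemidef) : 0 ≤ (P * X).trace := by
  obtain ⟨k, a, rfl⟩ := posSemidef_iff_eq_sum_vecMulVec.mp hX
  rw [Matrix.mul_sum, Matrix.trace_sum]
  refine Finset.sum_nonneg fun j _ => ?_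
  rw [mul_vecMulVec, trace_vecMulVec, dotProduct_comm]
  exact hP.dotProduct_mulVec_nonneg (a j)

section Design

variable {s l m : ℕ} (A : Fin s → Matrix (Fin l) (Fin m) ℝ)

lemma infoMat_transpose (w : Fin s → ℝ) : (infoMat A w)ᵀ = infoMat A w := by
  simp [infoMat, transpose_sum]

lemma infoMat_smul (t : ℝ) (w : Fin s → ℝ) : infoMat A (t • w) = t • infoMat A w := by
  simp [infoMat, Finset.smul_sum, smul_smul]

lemma dotProduct_infoMat_mulVec_comm (w : Fin s → ℝ) (x y : Fin m → ℝ) :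
    x ⬝ᵥ (infoMat A w *ᵥ y) = (infoMat A w *ᵥ x) ⬝ᵥ y := by
  rw [dotProduct_mulVec, ← mulVec_transpose, infoMat_transpose]

lemma dotProduct_infoMat_mulVec_self (w : Fin s → ℝ) (y : Fin m → ℝ) :
    y ⬝ᵥ (infoMat A w *ᵥ y) = ∑ i, w i * ((A i *ᵥ y) ⬝ᵥ (A i *ᵥ y)) := by
  rw [infoMat, sum_mulVec, dotProduct_sum]
  refine Finset.sum_congr rfl fun i _ => ?_
  rw [smul_mulVec, dotProduct_smul, smul_eq_mul, ← mulVec_mulVec, dotProduct_mulVec,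
    vecMul_transpose]

variable {A}

/-- Dual feasibility in terms of quadratic forms. -/
lemma dualSDPFeas_iff {c : Fin m → ℝ} {μ : Fin s → ℝ} :
    DualSDPFeas A c μ ↔
      (∀ i, 0 ≤ μ i) ∧ ∀ y, (c ⬝ᵥ y) ^ 2 ≤ y ⬝ᵥ (infoMat A μ *ᵥ y) := by
  have key : ∀ y, y ⬝ᵥ ((infoMat A μ - vecMulVec c c) *ᵥ y) =
      y ⬝ᵥ (infoMat A μ *ᵥ y) - (c ⬝ᵥ y) ^ 2 := fun y => by
    rw [sub_mulVec, dotProduct_sub, vecMulVec_mulVec, dotProduct_smul, dotProduct_comm y c]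
    simp [sq]
  refine and_congr_right fun _ => ⟨fun h y => ?_, fun h => ?_⟩
  · have := h.dotProduct_mulVec_nonneg y
    rw [star_trivial] at this
    linarith [key y, show y ⬝ᵥ ((infoMat A μ - vecMulVec c c) *ᵥ y) ≥ 0 from this]
  · refine PosSemidef.of_dotProduct_mulVec_nonneg ?_ fun y => ?_
    · rw [IsHermitian, conjTranspose_eq_transpose_of_trivial, transpose_sub, transpose_vecMulVec]
      exact congrArg (· - vecMulVec c c) (infoMat_transpose A μ)
    · rw [star_trivial]
      have := key y
      rw [infoMat] at this
      rw [this]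
      exact sub_nonneg.2 (h y)

/-- Weak duality for the pair of semidefinite programs. -/
lemma PrimalSDPFeas.le_sum {c : Fin m → ℝ} {X : Matrix (Fin m) (Fin m) ℝ} {μ : Fin s → ℝ}
    (hX : PrimalSDPFeas A X) (hμ : DualSDPFeas A c μ) : c ⬝ᵥ (X *ᵥ c) ≤ ∑ i, μ i := by
  have h := hμ.2.trace_mul_nonneg_real hX.1
  have h1 : (vecMulVec c c * X).trace = c ⬝ᵥ (X *ᵥ c) := by
    rw [vecMulVec_mul, trace_vecMulVec, dotProduct_mulVec, dotProduct_comm]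
  rw [Matrix.sub_mul, trace_sub, h1, Matrix.sum_mul, trace_sum] at h
  refine (sub_nonneg.1 h).trans (Finset.sum_le_sum fun i _ => ?_)
  rw [Matrix.smul_mul, trace_smul, smul_eq_mul, Matrix.mul_assoc, trace_mul_comm]
  exact mul_le_of_le_one_right (hμ.1 i) (hX.2 i)

lemma DualSDPFeas.exists_mulVec_eq {c : Fin m → ℝ} {μ : Fin s → ℝ} (hμ : DualSDPFeas A c μ) :
    ∃ u, infoMat A μ *ᵥ u = c := by
  obtain ⟨x, hx⟩ := exists_dotProduct_eq_of_ker_le (infoMat A μ).mulVecLin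
    (dotProductBilin ℝ ℝ c) fun z hz => by
      have := (dualSDPFeas_iff.1 hμ).2 z
      rw [mulVecLin_apply] at hz
      rw [hz, dotProduct_zero] at this
      exact pow_eq_zero_iff two_ne_zero |>.1 (le_antisymm this (sq_nonneg _))
  refine ⟨x, dotProduct_eq _ _ fun z => ?_⟩
  rw [← dotProduct_infoMat_mulVec_comm]
  exact (hx z).symm

lemma dotProduct_infoMat_mulVec_self_nonneg {w : Fin s → ℝ} (hw : ∀ i, 0 ≤ w i)
    (y : Fin m → ℝ) : 0 ≤ y ⬝ᵥ (infoMat A w *ᵥ y) := by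
  rw [dotProduct_infoMat_mulVec_self]
  exact Finset.sum_nonneg fun i _ => mul_nonneg (hw i) (dotProduct_self_star_nonneg _)

lemma dotProduct_pos_of_infoMat_mulVec_eq {c u : Fin m → ℝ} (hc : c ≠ 0) {w : Fin s → ℝ}
    (hw : ∀ i, 0 ≤ w i) (hu : infoMat A w *ᵥ u = c) : 0 < c ⬝ᵥ u := by
  have h0 : c ⬝ᵥ u = u ⬝ᵥ (infoMat A w *ᵥ u) := by rw [hu, dotProduct_comm]
  refine lt_of_le_of_ne (h0 ▸ dotProduct_infoMat_mulVec_self_nonneg hw u) fun h => hc ?_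
  have hnn : ∀ i ∈ Finset.univ, 0 ≤ w i * ((A i *ᵥ u) ⬝ᵥ (A i *ᵥ u)) := fun i _ =>
    mul_nonneg (hw i) (dotProduct_self_star_nonneg _)
  rw [h0, dotProduct_infoMat_mulVec_self, eq_comm, Finset.sum_eq_zero_iff_of_nonneg hnn] at h
  rw [← hu, infoMat, sum_mulVec]
  refine Finset.sum_eq_zero fun i hi => ?_
  rw [smul_mulVec, ← mulVec_mulVec]
  rcases mul_eq_zero.1 (h i hi) with h | h
  · rw [h, zero_smul]
  · rw [dotProduct_self_eq_zero.1 h, mulVec_zero, smul_zero]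

/-- Scaling nonnegative weights by their variance gives a dual feasible point. -/
lemma dualSDPFeas_smul_of_infoMat_mulVec_eq {c u : Fin m → ℝ} (hc : c ≠ 0) {w : Fin s → ℝ}
    (hw : ∀ i, 0 ≤ w i) (hu : infoMat A w *ᵥ u = c) : DualSDPFeas A c ((c ⬝ᵥ u) • w) := by
  have ht := dotProduct_pos_of_infoMat_mulVec_eq hc hw hu
  refine dualSDPFeas_iff.2 ⟨fun i => mul_nonneg ht.le (hw i), fun y => ?_⟩
  have h := dotProduct_infoMat_mulVec_self_nonneg hw ((c ⬝ᵥ u) • y - (c ⬝ᵥ y) • u) (A := A)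
  have huy : u ⬝ᵥ (infoMat A w *ᵥ y) = c ⬝ᵥ y := by rw [dotProduct_infoMat_mulVec_comm, hu]
  simp only [mulVec_sub, mulVec_smul, dotProduct_sub, sub_dotProduct, dotProduct_smul,
    smul_dotProduct, smul_eq_mul, huy, hu, dotProduct_comm y c, dotProduct_comm u c] at h
  rw [infoMat_smul, smul_mulVec, dotProduct_smul, smul_eq_mul]
  refine le_of_mul_le_mul_left ?_ ht
  linarith

/-- The map `z ↦ ∑ i, A iᵀ z i` on the `ℓ¹`-sum of Euclidean spaces. -/
noncomputable def elfvingMap (A : Fin s → Matrix (Fin l) (Fin m) ℝ) :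
    PiLp 1 (fun _ : Fin s => EuclideanSpace ℝ (Fin l)) →ₗ[ℝ] (Fin m → ℝ) where
  toFun z := ∑ i, (A i)ᵀ *ᵥ (z i).ofLp
  map_add' x y := by simp [mulVec_add, Finset.sum_add_distrib]
  map_smul' t x := by simp [mulVec_smul, Finset.smul_sum]

lemma elfvingMap_single (i : Fin s) (v : EuclideanSpace ℝ (Fin l)) :
    elfvingMap A (PiLp.single 1 i v) = (A i)ᵀ *ᵥ v.ofLp := by
  rw [elfvingMap, LinearMap.coe_mk, AddHom.coe_mk, Finset.sum_eq_single i]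
  · simp
  · intro j _ hj
    simp [if_neg hj]
  · simp

/-- Norm duality for `elfvingMap`: a minimal-norm representation of `c` together with a
certificate of its minimality. -/
lemma exists_elfvingMap_eq_and_dotProduct_eq_norm {c : Fin m → ℝ}
    (hrange : ∃ u, (∑ i, (A i)ᵀ * A i) *ᵥ u = c) :
    ∃ (z : PiLp 1 (fun _ : Fin s => EuclideanSpace ℝ (Fin l))) (x : Fin m → ℝ),
      elfvingMap A z = c ∧ x ⬝ᵥ c = ‖z‖ ∧ ∀ i, (A i *ᵥ x) ⬝ᵥ (A i *ᵥ x) ≤ 1 := by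
  obtain ⟨u, hu⟩ := hrange
  have hu' : elfvingMap A (WithLp.toLp 1 fun i => WithLp.toLp 2 (A i *ᵥ u)) = c := by
    rw [← hu, sum_mulVec, elfvingMap, LinearMap.coe_mk, AddHom.coe_mk]
    exact Finset.sum_congr rfl fun i _ => mulVec_mulVec u (A i)ᵀ (A i)
  obtain ⟨z, x, hz, hxz, hx⟩ := exists_map_eq_and_dotProduct_eq_norm (elfvingMap A)
    (WithLp.toLp 1 fun i => WithLp.toLp 2 (A i *ᵥ u))
  rw [hu'] at hz hxz
  refine ⟨z, x, hz, hxz, fun i => ?_⟩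
  let v : EuclideanSpace ℝ (Fin l) := WithLp.toLp 2 (A i *ᵥ x)
  have hv : ‖v‖ ^ 2 = (A i *ᵥ x) ⬝ᵥ (A i *ᵥ x) := by
    rw [EuclideanSpace.real_norm_sq_eq]
    exact Finset.sum_congr rfl fun j _ => sq _
  have h1 : (A i *ᵥ x) ⬝ᵥ (A i *ᵥ x) ≤ ‖v‖ := by
    have h2 := hx (PiLp.single 1 i v)
    rwa [elfvingMap_single, dotProduct_mulVec, vecMul_transpose, PiLp.norm_single] at h2
  rw [← hv] at h1 ⊢
  nlinarith [norm_nonneg v]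

/-- A representation `c = ∑ i, A iᵀ z i` yields a dual feasible point of value `‖z‖ ^ 2`. -/
lemma dualSDPFeas_of_elfvingMap_eq {c : Fin m → ℝ}
    {z : PiLp 1 (fun _ : Fin s => EuclideanSpace ℝ (Fin l))} (hz : elfvingMap A z = c) :
    DualSDPFeas A c fun i => ‖z‖ * ‖z i‖ := by
  refine dualSDPFeas_iff.2 ⟨fun i => by positivity, fun y => ?_⟩
  let b : Fin s → EuclideanSpace ℝ (Fin l) := fun i => WithLp.toLp 2 (A i *ᵥ y)
  have hb : ∀ i, (A i *ᵥ y) ⬝ᵥ (A i *ᵥ y) = ‖b i‖ ^ 2 := fun i => by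
    rw [EuclideanSpace.real_norm_sq_eq]
    exact Finset.sum_congr rfl fun j _ => (sq _).symm
  have h1 : |c ⬝ᵥ y| ≤ ∑ i, ‖z i‖ * ‖b i‖ := by
    rw [← hz, elfvingMap, LinearMap.coe_mk, AddHom.coe_mk, sum_dotProduct]
    refine (Finset.abs_sum_le_sum_abs _ _).trans (Finset.sum_le_sum fun i _ => ?_)
    rw [mulVec_transpose, ← dotProduct_mulVec, mul_comm]
    refine le_trans (le_of_eq ?_) (abs_real_inner_le_norm (b i) (z i))
    rw [EuclideanSpace.inner_eq_star_dotProduct, star_trivial]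
  have h2 : (∑ i, ‖z i‖ * ‖b i‖) ^ 2 ≤ (∑ i, ‖z i‖) * ∑ i, ‖z i‖ * ‖b i‖ ^ 2 :=
    Finset.sum_sq_le_sum_mul_sum_of_sq_le_mul _ (fun i _ => by positivity)
      (fun i _ => by positivity) fun i _ => le_of_eq (by ring)
  rw [dotProduct_infoMat_mulVec_self, ← sq_abs]
  refine (pow_le_pow_left₀ (abs_nonneg _) h1 2).trans (h2.trans_eq ?_)
  rw [← PiLp.norm_eq_of_L1, Finset.mul_sum]
  exact Finset.sum_congr rfl fun i _ => by rw [hb, mul_assoc]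

lemma primalSDPFeas_vecMulVec {x : Fin m → ℝ}
    (hx : ∀ i, (A i *ᵥ x) ⬝ᵥ (A i *ᵥ x) ≤ 1) : PrimalSDPFeas A (vecMulVec x x) := by
  refine ⟨by simpa using posSemidef_vecMulVec_self_star x, fun i => ?_⟩
  rw [mul_vecMulVec, vecMulVec_mul, vecMul_transpose, trace_vecMulVec]
  exact hx i

end Design

/-- **The `c`-optimality SDP.** The primal supremum of `cᵀ X c` and the dual infimum of
`∑ μ i` coincide and are both attained; moreover any dual optimizer `μ*` yields the
`c`-optimal design `w = μ* / (∑ μ*ᵢ)` with `V_c(w) = ∑ μ*ᵢ`. -/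
theorem cOptimal_SDP {s l m : ℕ} (A : Fin s → Matrix (Fin l) (Fin m) ℝ)
    (c : Fin m → ℝ) (hc : c ≠ 0)
    (hrange : ∃ u, (∑ i, (A i)ᵀ * A i) *ᵥ u = c) :
    (∃ (Xstar : Matrix (Fin m) (Fin m) ℝ) (μstar : Fin s → ℝ),
      PrimalSDPFeas A Xstar ∧ DualSDPFeas A c μstar ∧
      (∀ X, PrimalSDPFeas A X → c ⬝ᵥ (X *ᵥ c) ≤ c ⬝ᵥ (Xstar *ᵥ c)) ∧
      (∀ μ, DualSDPFeas A c μ → ∑ i, μstar i ≤ ∑ i, μ i) ∧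
      c ⬝ᵥ (Xstar *ᵥ c) = ∑ i, μstar i) ∧
    (∀ μstar : Fin s → ℝ, DualSDPFeas A c μstar →
      (∀ μ, DualSDPFeas A c μ → ∑ i, μstar i ≤ ∑ i, μ i) →
      IsCOptimal A c ((∑ i, μstar i)⁻¹ • μstar) ∧
      (∀ u, infoMat A ((∑ i, μstar i)⁻¹ • μstar) *ᵥ u = c →
        c ⬝ᵥ u = ∑ i, μstar i)) := by
  refine ⟨?_, fun μ hμ hmin => ?_⟩
  · obtain ⟨z, x, hz, hxc, hx⟩ := exists_elfvingMap_eq_and_dotProduct_eq_norm hrange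
    have hX := primalSDPFeas_vecMulVec hx
    have hμ := dualSDPFeas_of_elfvingMap_eq hz
    have hval : c ⬝ᵥ (vecMulVec x x *ᵥ c) = ∑ i, ‖z‖ * ‖z i‖ := by
      rw [← Finset.mul_sum, ← PiLp.norm_eq_of_L1, vecMulVec_mulVec, dotProduct_smul, hxc,
        dotProduct_comm, hxc]
      simp
    exact ⟨_, _, hX, hμ, fun X h => (h.le_sum hμ).trans_eq hval.symm,
      fun μ h => hval ▸ hX.le_sum h, hval⟩
  · set v := ∑ i, μ i
    obtain ⟨u₀, hu₀⟩ := hμ.exists_mulVec_eq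
    have hv : 0 < v := by
      refine lt_of_le_of_ne (Finset.sum_nonneg fun i _ => hμ.1 i) fun h => hc ?_
      have h0 : μ = 0 := funext fun i =>
        (Finset.sum_eq_zero_iff_of_nonneg fun i _ => hμ.1 i).1 h.symm i (Finset.mem_univ i)
      rw [← hu₀, h0]
      simp [infoMat]
    have hw : IsDesign (v⁻¹ • μ) :=
      ⟨fun i => mul_nonneg (inv_nonneg.2 hv.le) (hμ.1 i), by
        simp only [Pi.smul_apply, smul_eq_mul]
        rw [← Finset.mul_sum]
        exact inv_mul_cancel₀ hv.ne'⟩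
    have hlower : ∀ w' u', IsDesign w' → infoMat A w' *ᵥ u' = c → v ≤ c ⬝ᵥ u' := by
      intro w' u' hw' hu'
      have := hmin _ (dualSDPFeas_smul_of_infoMat_mulVec_eq hc hw'.1 hu')
      simp only [Pi.smul_apply, smul_eq_mul] at this
      rwa [← Finset.mul_sum, hw'.2, mul_one] at this
    have hvalue : ∀ u, infoMat A (v⁻¹ • μ) *ᵥ u = c → c ⬝ᵥ u = v := by
      intro u hu
      refine le_antisymm ?_ (hlower _ u hw hu)
      have hpos := dotProduct_pos_of_infoMat_mulVec_eq hc hw.1 hu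
      have h := (dualSDPFeas_iff.1 hμ).2 u
      rw [infoMat_smul, smul_mulVec, inv_smul_eq_iff₀ hv.ne'] at hu
      rw [hu, dotProduct_smul, smul_eq_mul, dotProduct_comm u c, sq] at h
      exact le_of_mul_le_mul_right h hpos
    refine ⟨⟨hw, ⟨v • u₀, ?_⟩, fun w' u u' hw' hu hu' => ?_⟩, hvalue⟩
    · rw [infoMat_smul, smul_mulVec, mulVec_smul, inv_smul_smul₀ hv.ne', hu₀]
    · exact (hvalue u hu).trans_le (hlower w' u' hw' hu')
end

section
/- Assume each c_k is nonzero and lies in the range of Σ_{i=1}^s A_{(k),i}^T A_{(k),i}. Then the following three quantities are equal: (1) the minimum over feasible designs w of S_β(w); (2) twice the infimum of Σ_{k=1}^r (−β_k log t_k) over all (t, (v_{ik}), w) with t ∈ ℝ^r, t_k > 0, v_{ik} ∈ ℝ^l for i ∈ {1,…,s} and k ∈ {1,…,r}, w ∈ ℝ^s with w ≥ 0 and Σ_i w_i ≤ 1, subject to t_k c_k = Σ_{i=1}^s A_{(k),i}^T v_{ik} for all k and Σ_{k=1}^r β_k ‖v_{ik}‖² ≤ w_i² for all i; (3) twice the supremum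 of Σ_{k=1}^r β_k log(c_k^T h_k / β_k) over all (h_1,…,h_r) ∈ (ℝ^m)^r with c_k^T h_k > 0 for all k and Σ_{k=1}^r ‖A_{(k),i} h_k‖² / β_k ≤ 1 for all i ∈ {1,…,s}. Moreover, if (t, (v_{ik}), w) attains the infimum in (2), then w minimizes S_β over feasible designs. -/
open Matrix BigOperators

/-- Euclidean norm on `Fin n → ℝ`. -/
noncomputable def euclNorm {n : ℕ} (v : Fin n → ℝ) : ℝ :=
  Real.sqrt (∑ i, v i ^ 2)

/-- Information matrix of the `k`-th model: `M_{(k)}(w) = ∑ i, w i • A k iᵀ A k i`. -/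
noncomputable def infoMatK {s l m r : ℕ}
    (A : Fin r → Fin s → Matrix (Fin l) (Fin m) ℝ) (k : Fin r) (w : Fin s → ℝ) :
    Matrix (Fin m) (Fin m) ℝ :=
  ∑ i, w i • ((A k i)ᵀ * A k i)

/-- `w` is feasible when every `c k` lies in the range of `M_{(k)}(w)`. -/
def FeasibleS {s l m r : ℕ} (A : Fin r → Fin s → Matrix (Fin l) (Fin m) ℝ)
    (c : Fin r → Fin m → ℝ) (w : Fin s → ℝ) : Prop :=
  ∀ k, ∃ u, infoMatK A k w *ᵥ u = c k

/-- The set of values of the `S_β`-criterion `∑ k, β k * log (c k ⬝ᵥ u k)` of `w`,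
over all witnesses `u k` with `M_{(k)}(w) (u k) = c k` (it is a singleton when `w` is
feasible, since the value does not depend on the witnesses). -/
def SVal {s l m r : ℕ} (A : Fin r → Fin s → Matrix (Fin l) (Fin m) ℝ)
    (c : Fin r → Fin m → ℝ) (β : Fin r → ℝ) (w : Fin s → ℝ) : Set ℝ :=
  {x | ∃ u : Fin r → Fin m → ℝ, (∀ k, infoMatK A k w *ᵥ u k = c k) ∧
    x = ∑ k, β k * Real.log (c k ⬝ᵥ u k)}

/-- Values of the primal geometric program `(P_β)`. -/
def PβVals {s l m r : ℕ} (A : Fin r → Fin s → Matrix (Fin l) (Fin m) ℝ)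
    (c : Fin r → Fin m → ℝ) (β : Fin r → ℝ) : Set ℝ :=
  {x | ∃ (t : Fin r → ℝ) (v : Fin s → Fin r → Fin l → ℝ) (w : Fin s → ℝ),
    (∀ k, 0 < t k) ∧ (∀ i, 0 ≤ w i) ∧ (∑ i, w i ≤ 1) ∧
    (∀ k, t k • c k = ∑ i, (A k i)ᵀ *ᵥ v i k) ∧
    (∀ i, ∑ k, β k * euclNorm (v i k) ^ 2 ≤ w i ^ 2) ∧
    x = ∑ k, -(β k * Real.log (t k))}

/-- Values of the dual geometric program `(D_β)`. -/
def DβVals {s l m r : ℕ} (A : Fin r → Fin s → Matrix (Fin l) (Fin m) ℝ)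
    (c : Fin r → Fin m → ℝ) (β : Fin r → ℝ) : Set ℝ :=
  {x | ∃ h : Fin r → Fin m → ℝ,
    (∀ k, 0 < c k ⬝ᵥ h k) ∧
    (∀ i, ∑ k, euclNorm (A k i *ᵥ h k) ^ 2 / β k ≤ 1) ∧
    x = ∑ k, β k * Real.log ((c k ⬝ᵥ h k) / β k)}

theorem euclNorm_sq {n : ℕ} (v : Fin n → ℝ) : euclNorm v ^ 2 = v ⬝ᵥ v := by
  rw [euclNorm, Real.sq_sqrt (Finset.sum_nonneg fun _ _ => sq_nonneg _)]
  simp [dotProduct, sq]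

theorem dotProduct_self_nonneg_real {n : ℕ} (v : Fin n → ℝ) : 0 ≤ v ⬝ᵥ v :=
  Finset.sum_nonneg fun _ _ => mul_self_nonneg _

theorem two_mul_dotProduct_le {n : ℕ} (v z : Fin n → ℝ) {a : ℝ} (ha : 0 < a) :
    2 * (v ⬝ᵥ z) ≤ (v ⬝ᵥ v) / a + a * (z ⬝ᵥ z) := by
  have h := dotProduct_self_nonneg_real (v - a • z)
  have e : (v - a • z) ⬝ᵥ (v - a • z) = v ⬝ᵥ v - 2 * a * (v ⬝ᵥ z) + a ^ 2 * (z ⬝ᵥ z) := by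
    simp only [sub_dotProduct, dotProduct_sub, smul_dotProduct, dotProduct_smul, smul_eq_mul]
    rw [dotProduct_comm z v]
    ring
  rw [e] at h
  have : v ⬝ᵥ v / a + a * (z ⬝ᵥ z) - 2 * (v ⬝ᵥ z)
      = (v ⬝ᵥ v - 2 * a * (v ⬝ᵥ z) + a ^ 2 * (z ⬝ᵥ z)) / a := by
    field_simp
    ring
  have := div_nonneg h ha.le
  linarith

theorem sum_mul_log_le_log {ι : Type*} [Fintype ι] {β x : ι → ℝ} (hβ : ∀ k, 0 < β k)
    (hβ1 : ∑ k, β k = 1) (hx : ∀ k, 0 < x k) {W : ℝ} (hW : ∑ k, β k * x k ≤ W) :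
    ∑ k, β k * Real.log (x k) ≤ Real.log W := by
  have hne : (Finset.univ : Finset ι).Nonempty := by
    by_contra h
    simp [Finset.not_nonempty_iff_eq_empty.1 h] at hβ1
  have hpos : 0 < ∑ k, β k * x k := Finset.sum_pos (fun k _ => mul_pos (hβ k) (hx k)) hne
  have := strictConcaveOn_log_Ioi.concaveOn.le_map_sum (t := Finset.univ) (w := β) (p := x)
    (fun k _ => (hβ k).le) hβ1 (fun k _ => hx k)
  simp only [smul_eq_mul] at this
  exact this.trans (Real.log_le_log hpos hW)

theorem mulVec_infoMatK {s l m r : ℕ} (A : Fin r → Fin s → Matrix (Fin l) (Fin m) ℝ) (k : Fin r)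
    (w : Fin s → ℝ) (u : Fin m → ℝ) :
    infoMatK A k w *ᵥ u = ∑ i, w i • ((A k i)ᵀ *ᵥ (A k i *ᵥ u)) := by
  simp [infoMatK, sum_mulVec, smul_mulVec, mulVec_mulVec]

theorem transpose_mulVec_dotProduct {l m : ℕ} (B : Matrix (Fin l) (Fin m) ℝ) (v : Fin l → ℝ)
    (x : Fin m → ℝ) : (Bᵀ *ᵥ v) ⬝ᵥ x = v ⬝ᵥ (B *ᵥ x) := by
  rw [mulVec_transpose, dotProduct_mulVec]

theorem infoMatK_mulVec_dotProduct {s l m r : ℕ} (A : Fin r → Fin s → Matrix (Fin l) (Fin m) ℝ)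
    (k : Fin r) (w : Fin s → ℝ) (u x : Fin m → ℝ) :
    (infoMatK A k w *ᵥ u) ⬝ᵥ x = ∑ i, w i * ((A k i *ᵥ u) ⬝ᵥ (A k i *ᵥ x)) := by
  simp only [mulVec_infoMatK, sum_dotProduct, smul_dotProduct, transpose_mulVec_dotProduct,
    smul_eq_mul]

theorem dotProduct_pos_of_infoMatK_mulVec_eq {s l m r : ℕ}
    {A : Fin r → Fin s → Matrix (Fin l) (Fin m) ℝ} {k : Fin r} {w : Fin s → ℝ}
    (hw : ∀ i, 0 ≤ w i) {c u : Fin m → ℝ} (hc : c ≠ 0) (hu : infoMatK A k w *ᵥ u = c) :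
    0 < c ⬝ᵥ u := by
  have e := infoMatK_mulVec_dotProduct A k w u u
  rw [hu] at e
  have hnn : ∀ i ∈ Finset.univ, 0 ≤ w i * ((A k i *ᵥ u) ⬝ᵥ (A k i *ᵥ u)) :=
    fun i _ => mul_nonneg (hw i) (dotProduct_self_nonneg_real _)
  rw [e]
  refine (Finset.sum_nonneg hnn).lt_of_ne fun h0 => hc ?_
  rw [← hu, mulVec_infoMatK]
  refine Finset.sum_eq_zero fun i hi => ?_
  rcases mul_eq_zero.1 ((Finset.sum_eq_zero_iff_of_nonneg hnn).1 h0.symm i hi) with h | h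
  · simp [h]
  · simp [dotProduct_self_eq_zero.1 h]

/-- A vector orthogonal to the null space of the information matrix lies in its range. -/
theorem exists_infoMatK_mulVec_eq {s l m r : ℕ} {A : Fin r → Fin s → Matrix (Fin l) (Fin m) ℝ}
    {k : Fin r} {w : Fin s → ℝ} (hw : ∀ i, 0 ≤ w i) {c : Fin m → ℝ}
    (hc : ∀ x, (∀ i, w i ≠ 0 → A k i *ᵥ x = 0) → c ⬝ᵥ x = 0) :
    ∃ u, infoMatK A k w *ᵥ u = c := by
  by_contra h
  have hmem : c ∉ LinearMap.range (infoMatK A k w).mulVecLin := by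
    rintro ⟨u, hu⟩
    exact h ⟨u, hu⟩
  obtain ⟨f, hfc, hf⟩ := Submodule.exists_le_ker_of_notMem hmem
  obtain ⟨x, rfl⟩ := (dotProductEquiv ℝ (Fin m)).surjective f
  refine hfc ?_
  have h0 := hf ⟨x, rfl⟩
  simp only [LinearMap.mem_ker, dotProductEquiv_apply_apply, mulVecLin_apply] at h0 ⊢
  rw [dotProduct_comm, infoMatK_mulVec_dotProduct] at h0
  rw [dotProduct_comm]
  refine hc x fun i hi => ?_
  rcases mul_eq_zero.1 ((Finset.sum_eq_zero_iff_of_nonneg fun i _ =>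
    mul_nonneg (hw i) (dotProduct_self_nonneg_real _)).1 h0 i (Finset.mem_univ i)) with h | h
  · exact absurd h hi
  · exact dotProduct_self_eq_zero.1 h

theorem eq_zero_of_sum_mul_euclNorm_sq_le {l r : ℕ} {β : Fin r → ℝ} (hβ : ∀ k, 0 < β k)
    {v : Fin r → Fin l → ℝ} {a : ℝ} (h : ∑ k, β k * euclNorm (v k) ^ 2 ≤ a ^ 2) (ha : a = 0)
    (k : Fin r) : v k = 0 := by
  have hnn : ∀ k ∈ Finset.univ, 0 ≤ β k * euclNorm (v k) ^ 2 :=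
    fun k _ => mul_nonneg (hβ k).le (sq_nonneg _)
  have h0 : ∑ k, β k * euclNorm (v k) ^ 2 = 0 :=
    le_antisymm (h.trans (by simp [ha])) (Finset.sum_nonneg hnn)
  have := (Finset.sum_eq_zero_iff_of_nonneg hnn).1 h0 k (Finset.mem_univ k)
  rw [euclNorm_sq] at this
  exact dotProduct_self_eq_zero.1 ((mul_eq_zero.1 this).resolve_left (hβ k).ne')

/-- Weak duality between the two geometric programs. -/
theorem le_of_mem_DβVals_of_mem_PβVals {s l m r : ℕ}
    {A : Fin r → Fin s → Matrix (Fin l) (Fin m) ℝ} {c : Fin r → Fin m → ℝ} {β : Fin r → ℝ}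
    (hβ : ∀ k, 0 < β k) (hβ1 : ∑ k, β k = 1) {x y : ℝ} (hy : y ∈ DβVals A c β)
    (hx : x ∈ PβVals A c β) : y ≤ x := by
  obtain ⟨h, hh, hA, rfl⟩ := hy
  obtain ⟨t, v, w, ht, hw, hw1, htc, hv, rfl⟩ := hx
  have key : ∑ k, t k * (c k ⬝ᵥ h k) ≤ 1 := by
    have e : ∑ k, t k * (c k ⬝ᵥ h k) = ∑ i, ∑ k, v i k ⬝ᵥ (A k i *ᵥ h k) := by
      rw [Finset.sum_comm]
      refine Finset.sum_congr rfl fun k _ => ?_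
      rw [← smul_eq_mul, ← smul_dotProduct, htc k, sum_dotProduct]
      simp only [transpose_mulVec_dotProduct]
    rw [e]
    refine (Finset.sum_le_sum fun i _ => ?_).trans hw1
    rcases (hw i).eq_or_lt with h0 | hpos
    · simp [eq_zero_of_sum_mul_euclNorm_sq_le hβ (hv i) h0.symm, ← h0]
    · have h1 : ∑ k, 2 * (v i k ⬝ᵥ (A k i *ᵥ h k)) ≤
          ∑ k, (β k * euclNorm (v i k) ^ 2 / w i + w i * (euclNorm (A k i *ᵥ h k) ^ 2 / β k)) := by
        refine Finset.sum_le_sum fun k _ => ?_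
        have := two_mul_dotProduct_le (v i k) (A k i *ᵥ h k) (div_pos hpos (hβ k))
        rw [euclNorm_sq, euclNorm_sq]
        refine this.trans (le_of_eq ?_)
        have := (hβ k).ne'
        field_simp
      rw [Finset.sum_add_distrib, ← Finset.mul_sum, ← Finset.mul_sum, ← Finset.sum_div] at h1
      have h2 := div_le_div_of_nonneg_right (hv i) hpos.le
      have h3 := mul_le_mul_of_nonneg_left (hA i) hpos.le
      have h4 : w i ^ 2 / w i = w i := by field_simp
      linarith
  have hJ := sum_mul_log_le_log (x := fun k => t k * ((c k ⬝ᵥ h k) / β k)) hβ hβ1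
    (fun k => mul_pos (ht k) (div_pos (hh k) (hβ k))) (W := 1) (by
      refine le_trans (le_of_eq (Finset.sum_congr rfl fun k _ => ?_)) key
      have := (hβ k).ne'
      field_simp)
  rw [Real.log_one] at hJ
  simp only [Real.log_mul (ht _).ne' (div_pos (hh _) (hβ _)).ne', mul_add,
    Finset.sum_add_distrib] at hJ
  rw [Finset.sum_neg_distrib]
  linarith

/-- Every criterion value of a feasible design is twice a value of the primal program. -/
theorem half_mem_PβVals_of_mem_SVal {s l m r : ℕ}
    {A : Fin r → Fin s → Matrix (Fin l) (Fin m) ℝ} {c : Fin r → Fin m → ℝ} {β : Fin r → ℝ}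
    (hβ : ∀ k, 0 < β k) (hβ1 : ∑ k, β k = 1) (hc : ∀ k, c k ≠ 0) {w : Fin s → ℝ}
    (hw : IsDesign w) {x : ℝ} (hx : x ∈ SVal A c β w) : x / 2 ∈ PβVals A c β := by
  obtain ⟨u, hu, rfl⟩ := hx
  have hρ : ∀ k, 0 < c k ⬝ᵥ u k := fun k =>
    dotProduct_pos_of_infoMatK_mulVec_eq hw.1 (hc k) (hu k)
  set t : Fin r → ℝ := fun k => (Real.sqrt (c k ⬝ᵥ u k))⁻¹ with ht
  have htpos : ∀ k, 0 < t k := fun k => inv_pos.2 (Real.sqrt_pos.2 (hρ k))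
  have htsq : ∀ k, t k ^ 2 * (c k ⬝ᵥ u k) = 1 := fun k => by
    simp only [ht, inv_pow, Real.sq_sqrt (hρ k).le]
    exact inv_mul_cancel₀ (hρ k).ne'
  set g : Fin s → ℝ := fun i => ∑ k, β k * t k ^ 2 * euclNorm (A k i *ᵥ u k) ^ 2 with hg
  have hg0 : ∀ i, 0 ≤ g i := fun i => Finset.sum_nonneg fun k _ => by
    have := hβ k
    positivity
  have hwg : ∑ i, w i * g i = 1 := by
    simp only [hg, Finset.mul_sum]
    rw [Finset.sum_comm, ← hβ1]
    refine Finset.sum_congr rfl fun k _ => ?_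
    have e := infoMatK_mulVec_dotProduct A k w (u k) (u k)
    rw [hu k] at e
    calc _ = β k * (t k ^ 2 * (c k ⬝ᵥ u k)) := by
          rw [e, Finset.mul_sum, Finset.mul_sum]
          refine Finset.sum_congr rfl fun i _ => ?_
          rw [euclNorm_sq]
          ring
      _ = β k := by rw [htsq, mul_one]
  refine ⟨t, fun i k => (t k * w i) • (A k i *ᵥ u k), fun i => w i * Real.sqrt (g i), htpos,
    fun i => mul_nonneg (hw.1 i) (Real.sqrt_nonneg _), ?_, fun k => ?_, fun i => le_of_eq ?_, ?_⟩
  · have h1 : ∑ i, w i * Real.sqrt (g i) ≤ ∑ i, (w i + w i * g i) / 2 := by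
      refine Finset.sum_le_sum fun i _ => ?_
      have : Real.sqrt (g i) ≤ (1 + g i) / 2 := by
        nlinarith [sq_nonneg (Real.sqrt (g i) - 1), Real.sq_sqrt (hg0 i)]
      nlinarith [mul_le_mul_of_nonneg_left this (hw.1 i)]
    rw [← Finset.sum_div, Finset.sum_add_distrib, hw.2, hwg] at h1
    linarith
  · rw [← hu k, mulVec_infoMatK, Finset.smul_sum]
    simp only [mulVec_smul, smul_smul]
  · rw [mul_pow, Real.sq_sqrt (hg0 i), hg, Finset.mul_sum]
    refine Finset.sum_congr rfl fun k _ => ?_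
    simp only [euclNorm_sq, smul_dotProduct, dotProduct_smul, smul_eq_mul]
    ring
  · rw [Finset.sum_div]
    refine Finset.sum_congr rfl fun k _ => ?_
    simp only [ht, Real.log_inv, Real.log_sqrt (hρ k).le]
    ring

/-- The weights of a point of the primal program are feasible, and their criterion value is
controlled by the value of the program. -/
theorem feasibleS_and_SVal_le {s l m r : ℕ}
    {A : Fin r → Fin s → Matrix (Fin l) (Fin m) ℝ} {c : Fin r → Fin m → ℝ} {β : Fin r → ℝ}
    (hβ : ∀ k, 0 < β k) (hβ1 : ∑ k, β k = 1) (hc : ∀ k, c k ≠ 0)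
    {t : Fin r → ℝ} {v : Fin s → Fin r → Fin l → ℝ} {w : Fin s → ℝ}
    (ht : ∀ k, 0 < t k) (hw : ∀ i, 0 ≤ w i)
    (htc : ∀ k, t k • c k = ∑ i, (A k i)ᵀ *ᵥ v i k)
    (hv : ∀ i, ∑ k, β k * euclNorm (v i k) ^ 2 ≤ w i ^ 2) :
    FeasibleS A c w ∧ ∀ x ∈ SVal A c β w,
      x ≤ 2 * (∑ k, -(β k * Real.log (t k))) + Real.log (∑ i, w i) := by
  have htcx : ∀ k x, t k * (c k ⬝ᵥ x) = ∑ i, v i k ⬝ᵥ (A k i *ᵥ x) := fun k x => by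
    rw [← smul_eq_mul, ← smul_dotProduct, htc k, sum_dotProduct]
    simp only [transpose_mulVec_dotProduct]
  have hv0 : ∀ i, w i = 0 → ∀ k, v i k = 0 := fun i hi k =>
    eq_zero_of_sum_mul_euclNorm_sq_le hβ (hv i) hi k
  refine ⟨fun k => exists_infoMatK_mulVec_eq hw fun x hx => ?_, ?_⟩
  · refine (mul_eq_zero.1 ((htcx k x).trans (Finset.sum_eq_zero fun i _ => ?_))).resolve_left
      (ht k).ne'
    by_cases hi : w i = 0
    · simp [hv0 i hi]
    · simp [hx i hi]
  · rintro _ ⟨u, hu, rfl⟩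
    have hρ : ∀ k, 0 < c k ⬝ᵥ u k := fun k =>
      dotProduct_pos_of_infoMatK_mulVec_eq hw (hc k) (hu k)
    have hbound : ∀ k, t k ^ 2 * (c k ⬝ᵥ u k) ≤ ∑ i, euclNorm (v i k) ^ 2 / w i := by
      intro k
      have e := infoMatK_mulVec_dotProduct A k w (u k) (u k)
      rw [hu k] at e
      have h1 : ∑ i, 2 * (v i k ⬝ᵥ (A k i *ᵥ (t k • u k))) ≤
          ∑ i, (euclNorm (v i k) ^ 2 / w i +
            t k ^ 2 * (w i * ((A k i *ᵥ u k) ⬝ᵥ (A k i *ᵥ u k)))) := by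
        refine Finset.sum_le_sum fun i _ => ?_
        rcases (hw i).eq_or_lt with h0 | hpos
        · simp [hv0 i h0.symm, ← h0]
        · refine (two_mul_dotProduct_le _ _ hpos).trans (le_of_eq ?_)
          rw [euclNorm_sq]
          simp only [mulVec_smul, smul_dotProduct, dotProduct_smul, smul_eq_mul]
          ring
      rw [Finset.sum_add_distrib, ← Finset.mul_sum, ← Finset.mul_sum, ← htcx, ← e,
        dotProduct_smul, smul_eq_mul] at h1
      nlinarith
    have hsum : ∑ k, β k * (t k ^ 2 * (c k ⬝ᵥ u k)) ≤ ∑ i, w i := by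
      calc _ ≤ ∑ k, β k * ∑ i, euclNorm (v i k) ^ 2 / w i :=
            Finset.sum_le_sum fun k _ => mul_le_mul_of_nonneg_left (hbound k) (hβ k).le
        _ = ∑ i, (∑ k, β k * euclNorm (v i k) ^ 2) / w i := by
            simp only [Finset.mul_sum, Finset.sum_div]
            rw [Finset.sum_comm]
            simp only [mul_div_assoc]
        _ ≤ ∑ i, w i := by
            refine Finset.sum_le_sum fun i _ => ?_
            rcases (hw i).eq_or_lt with h0 | hpos
            · simp [← h0]
            · rw [div_le_iff₀ hpos, ← sq]
              exact hv i
    have hJ := sum_mul_log_le_log hβ hβ1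
      (fun k => mul_pos (pow_pos (ht k) 2) (hρ k)) hsum
    simp only [Real.log_mul (pow_pos (ht _) 2).ne' (hρ _).ne', Real.log_pow, mul_add,
      Finset.sum_add_distrib] at hJ
    rw [Finset.sum_neg_distrib, mul_neg, Finset.mul_sum]
    have e : ∑ k, β k * (((2 : ℕ) : ℝ) * Real.log (t k)) = ∑ k, 2 * (β k * Real.log (t k)) :=
      Finset.sum_congr rfl fun k _ => by push_cast; ring
    linarith

/-- The maximizer over the unit ball of a weighted geometric mean of linear functionals
satisfies the first-order optimality condition. -/
theorem exists_closedBall_sum_div_le_one {V ι : Type*} [NormedAddCommGroup V] [NormedSpace ℝ V]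
    [FiniteDimensional ℝ V] [Fintype ι] {β : ι → ℝ} (hβ : ∀ k, 0 < β k) (hβ1 : ∑ k, β k = 1)
    (f : ι → V →L[ℝ] ℝ) (hf : ∃ z, ∀ k, 0 < f k z) :
    ∃ z, ‖z‖ ≤ 1 ∧ (∀ k, 0 < f k z) ∧ ∀ y, ‖y‖ ≤ 1 → ∑ k, β k * (f k y / f k z) ≤ 1 := by
  have : ProperSpace V := FiniteDimensional.proper ℝ V
  let P : V → ℝ := fun z => ∏ k, (max 0 (f k z)) ^ β k
  have hP : Continuous P := continuous_finsetProd _ fun k _ =>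
    (continuous_const.max (f k).continuous).rpow_const fun _ => Or.inr (hβ k).le
  obtain ⟨z, hz, hmax⟩ := (isCompact_closedBall (0 : V) 1).exists_isMaxOn
    ⟨0, by simp⟩ hP.continuousOn
  rw [mem_closedBall_zero_iff] at hz
  have hPpos : ∀ y, (∀ k, 0 < f k y) → 0 < P y := fun y hy =>
    Finset.prod_pos fun k _ => Real.rpow_pos_of_pos (lt_max_of_lt_right (hy k)) _
  have hPz : 0 < P z := by
    obtain ⟨z₀, hz₀⟩ := hf
    have hN : 0 < 1 + ‖z₀‖ := by positivity
    refine (hPpos ((1 + ‖z₀‖)⁻¹ • z₀) fun k => ?_).trans_le (hmax ?_)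
    · rw [map_smul, smul_eq_mul]
      exact mul_pos (inv_pos.2 hN) (hz₀ k)
    · rw [mem_closedBall_zero_iff, norm_smul, norm_inv, Real.norm_of_nonneg hN.le,
        inv_mul_le_iff₀ hN]
      linarith
  have hfz : ∀ k, 0 < f k z := by
    intro k
    by_contra hk
    refine hPz.ne' (Finset.prod_eq_zero (Finset.mem_univ k) ?_)
    rw [max_eq_left (not_lt.1 hk), Real.zero_rpow (hβ k).ne']
  have hlogP : ∀ y, (∀ k, 0 < f k y) → Real.log (P y) = ∑ k, β k * Real.log (f k y) := by
    intro y hy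
    rw [Real.log_prod fun k _ => (Real.rpow_pos_of_pos (lt_max_of_lt_right (hy k)) _).ne']
    exact Finset.sum_congr rfl fun k _ => by rw [max_eq_right (hy k).le, Real.log_rpow (hy k)]
  refine ⟨z, hz, hfz, fun y hy => ?_⟩
  set e : ι → ℝ := fun k => f k y / f k z - 1 with he
  have hcont : ∀ k, ContinuousAt (fun ε : ℝ => 1 + ε * e k) 0 := fun k => by fun_prop
  have hlim : Filter.Tendsto (fun ε : ℝ => ∑ k, β k * (e k / (1 + ε * e k)))
      (nhdsWithin 0 (Set.Ioi 0)) (nhds (∑ k, β k * e k)) := by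
    have : ContinuousAt (fun ε : ℝ => ∑ k, β k * (e k / (1 + ε * e k))) 0 := by
      refine tendsto_finsetSum _ fun k _ => ?_
      exact continuousAt_const.mul (continuousAt_const.div (hcont k) (by simp))
    simpa using this.tendsto.mono_left nhdsWithin_le_nhds
  have hle : ∀ᶠ ε : ℝ in nhdsWithin 0 (Set.Ioi 0), ∑ k, β k * (e k / (1 + ε * e k)) ≤ 0 := by
    have hpos : ∀ᶠ ε : ℝ in nhdsWithin 0 (Set.Ioi 0), ∀ k, 0 < 1 + ε * e k :=
      Filter.eventually_all.2 fun k =>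
        nhdsWithin_le_nhds ((hcont k).eventually (lt_mem_nhds (by simp)))
    filter_upwards [hpos, self_mem_nhdsWithin,
      nhdsWithin_le_nhds (gt_mem_nhds (zero_lt_one' ℝ))] with ε hε (hε0 : 0 < ε) hε1
    set x : V := (1 - ε) • z + ε • y with hx
    have hfx : ∀ k, f k x = f k z * (1 + ε * e k) := fun k => by
      have := (hfz k).ne'
      simp only [hx, he, map_add, map_smul, smul_eq_mul]
      field_simp
      ring
    have hfx0 : ∀ k, 0 < f k x := fun k => by
      rw [hfx]
      exact mul_pos (hfz k) (hε k)
    have hxb : x ∈ Metric.closedBall (0 : V) 1 :=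
      convex_closedBall (0 : V) 1 (by simpa using hz) (by simpa using hy) (by linarith) hε0.le
        (by ring)
    have h1 := Real.log_le_log (hPpos x hfx0) (hmax hxb)
    rw [hlogP x hfx0, hlogP z hfz] at h1
    have hsplit : ∀ k, β k * Real.log (f k x) =
        β k * Real.log (f k z) + β k * Real.log (1 + ε * e k) := fun k => by
      rw [hfx, Real.log_mul (hfz k).ne' (hε k).ne', mul_add]
    simp only [hsplit, Finset.sum_add_distrib] at h1
    have h2 : ∑ k, β k * (ε * (e k / (1 + ε * e k))) ≤ ∑ k, β k * Real.log (1 + ε * e k) := by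
      refine Finset.sum_le_sum fun k _ => mul_le_mul_of_nonneg_left ?_ (hβ k).le
      refine le_trans (le_of_eq ?_) (Real.one_sub_inv_le_log_of_pos (hε k))
      have := (hε k).ne'
      field_simp
      ring
    simp only [mul_left_comm _ ε, ← Finset.mul_sum] at h2
    nlinarith
  have := le_of_tendsto hlim hle
  simp only [he, mul_sub, mul_one, Finset.sum_sub_distrib, hβ1] at this
  linarith

/-- Riesz representation of functionals on a finite sup-norm product of Hilbert spaces. -/
theorem exists_sum_inner_eq_and_sum_norm_le {ι F : Type*} [Fintype ι] [NormedAddCommGroup F]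
    [InnerProductSpace ℝ F] [CompleteSpace F] (g : StrongDual ℝ (ι → F)) :
    ∃ y : ι → F, (∀ z, g z = ∑ i, inner ℝ (y i) (z i)) ∧ ∑ i, ‖y i‖ ≤ ‖g‖ := by
  classical
  let y : ι → F := fun i =>
    (InnerProductSpace.toDual ℝ F).symm (g.comp (ContinuousLinearMap.single ℝ (fun _ => F) i))
  have hy : ∀ z, g z = ∑ i, inner ℝ (y i) (z i) := by
    intro z
    conv_lhs => rw [← Finset.univ_sum_single z]
    rw [map_sum]
    refine Finset.sum_congr rfl fun i _ => ?_
    simp [y, InnerProductSpace.toDual_symm_apply]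
  refine ⟨y, hy, ?_⟩
  let z : ι → F := fun i => ‖y i‖⁻¹ • y i
  have hz : ‖z‖ ≤ 1 := by
    refine (pi_norm_le_iff_of_nonneg zero_le_one).2 fun i => ?_
    rw [norm_smul, norm_inv, norm_norm]
    exact inv_mul_le_one
  calc ∑ i, ‖y i‖ = g z := by
        rw [hy]
        refine Finset.sum_congr rfl fun i _ => ?_
        rw [inner_smul_right, real_inner_self_eq_norm_sq]
        rcases eq_or_ne ‖y i‖ 0 with h | h
        · simp [h]
        · field_simp
    _ ≤ ‖g z‖ := Real.le_norm_self _
    _ ≤ ‖g‖ := g.unit_le_opNorm z hz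

/-- The linear map sending `h` to the vectors of all `A k i *ᵥ h k`, scaled by `(β k)⁻¹ᐟ²`. -/
noncomputable def scaledObservation {s l m r : ℕ}
    (A : Fin r → Fin s → Matrix (Fin l) (Fin m) ℝ) (β : Fin r → ℝ) :
    (Fin r → Fin m → ℝ) →ₗ[ℝ] (Fin s → EuclideanSpace ℝ (Fin r × Fin l)) where
  toFun h i := WithLp.toLp 2 fun p => (A p.1 i *ᵥ h p.1) p.2 / Real.sqrt (β p.1)
  map_add' h h' := by
    ext i p
    simp [mulVec_add, add_div]
  map_smul' a h := by
    ext i p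
    simp [mulVec_smul, mul_div_assoc]

theorem inner_scaledObservation {s l m r : ℕ} (A : Fin r → Fin s → Matrix (Fin l) (Fin m) ℝ)
    (β : Fin r → ℝ) (h : Fin r → Fin m → ℝ) (i : Fin s) (y : EuclideanSpace ℝ (Fin r × Fin l)) :
    inner ℝ y (scaledObservation A β h i) =
      ∑ k, (fun j => y (k, j) / Real.sqrt (β k)) ⬝ᵥ (A k i *ᵥ h k) := by
  simp only [PiLp.inner_apply, scaledObservation, LinearMap.coe_mk, AddHom.coe_mk,
    Fintype.sum_prod_type, dotProduct]
  refine Finset.sum_congr rfl fun k _ => Finset.sum_congr rfl fun j _ => ?_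
  simp only [RCLike.inner_apply, conj_trivial]
  ring

theorem norm_sq_scaledObservation {s l m r : ℕ} (A : Fin r → Fin s → Matrix (Fin l) (Fin m) ℝ)
    {β : Fin r → ℝ} (hβ : ∀ k, 0 < β k) (h : Fin r → Fin m → ℝ) (i : Fin s) :
    ‖scaledObservation A β h i‖ ^ 2 = ∑ k, euclNorm (A k i *ᵥ h k) ^ 2 / β k := by
  rw [← real_inner_self_eq_norm_sq, inner_scaledObservation]
  refine Finset.sum_congr rfl fun k _ => ?_
  simp only [scaledObservation, LinearMap.coe_mk, AddHom.coe_mk, euclNorm_sq, dotProduct,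
    Finset.sum_div, div_div, Real.mul_self_sqrt (hβ k).le]
  exact Finset.sum_congr rfl fun j _ => by ring

/-- Strong duality with attainment on both sides. -/
theorem exists_mem_PβVals_mem_DβVals {s l m r : ℕ}
    {A : Fin r → Fin s → Matrix (Fin l) (Fin m) ℝ} {c : Fin r → Fin m → ℝ} {β : Fin r → ℝ}
    (hβ : ∀ k, 0 < β k) (hβ1 : ∑ k, β k = 1) (hc : ∀ k, c k ≠ 0)
    (hrange : ∀ k, ∃ u, (∑ i, (A k i)ᵀ * A k i) *ᵥ u = c k) :
    ∃ x, x ∈ PβVals A c β ∧ x ∈ DβVals A c β := by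
  choose u hu using hrange
  have hM : ∀ k, infoMatK A k (fun _ => 1) *ᵥ u k = c k := fun k => by
    simpa [infoMatK] using hu k
  let B := scaledObservation A β
  let f : Fin r → (Fin s → EuclideanSpace ℝ (Fin r × Fin l)) →L[ℝ] ℝ := fun k =>
    ∑ i, (innerSL ℝ (WithLp.toLp 2 fun p : Fin r × Fin l =>
      if p.1 = k then Real.sqrt (β k) * (A k i *ᵥ u k) p.2 else 0)).comp
        (ContinuousLinearMap.proj i)
  have hfB : ∀ k h, f k (B h) = c k ⬝ᵥ h k := by
    intro k h
    rw [← hM k, infoMatK_mulVec_dotProduct]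
    simp only [f, _root_.sum_apply, ContinuousLinearMap.comp_apply,
      ContinuousLinearMap.proj_apply, innerSL_apply_apply, B, inner_scaledObservation, one_mul]
    refine Finset.sum_congr rfl fun i _ => ?_
    rw [Finset.sum_eq_single k (fun k' _ hk' => by simp [dotProduct, hk']) (by simp)]
    have := (Real.sqrt_pos.2 (hβ k)).ne'
    simp [mul_div_cancel_left₀, this]
  let V := LinearMap.range B
  obtain ⟨⟨_, h, rfl⟩, hz1, hzpos, hz⟩ := exists_closedBall_sum_div_le_one hβ hβ1
    (fun k => (f k).comp V.subtypeL) ⟨⟨B u, u, rfl⟩, fun k =>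
      (dotProduct_pos_of_infoMatK_mulVec_eq (fun _ => zero_le_one) (hc k) (hM k)).trans_eq
        (hfB k u).symm⟩
  have hγ : ∀ k, 0 < c k ⬝ᵥ h k := fun k => (hzpos k).trans_eq (hfB k h)
  let φ : StrongDual ℝ V := ∑ k, (β k / (c k ⬝ᵥ h k)) • (f k).comp V.subtypeL
  have hφ1 : ∀ y, ‖y‖ ≤ 1 → φ y ≤ 1 := fun y hy => by
    refine le_trans (le_of_eq ?_) (hz y hy)
    simp only [φ, _root_.sum_apply, _root_.smul_apply, smul_eq_mul]
    refine Finset.sum_congr rfl fun k _ => ?_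
    rw [div_mul_eq_mul_div, mul_div_assoc]
    congr 2
    exact (hfB k h).symm
  have hφ : ‖φ‖ ≤ 1 := φ.opNorm_le_of_unit_norm zero_le_one fun y hy => by
    rw [Real.norm_eq_abs, abs_le']
    refine ⟨hφ1 y hy.le, ?_⟩
    rw [← map_neg]
    exact hφ1 (-y) (by rw [norm_neg, hy])
  obtain ⟨g, hgφ, hg⟩ := exists_extension_norm_eq V φ
  obtain ⟨y, hgy, hy⟩ := exists_sum_inner_eq_and_sum_norm_le g
  have hgB : ∀ h' : Fin r → Fin m → ℝ, ∑ k, (β k / (c k ⬝ᵥ h k)) * (c k ⬝ᵥ h' k) =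
      ∑ k, (∑ i, (A k i)ᵀ *ᵥ fun j => y i (k, j) / Real.sqrt (β k)) ⬝ᵥ h' k := by
    intro h'
    have e1 : g (B h') = ∑ k, (β k / (c k ⬝ᵥ h k)) * (c k ⬝ᵥ h' k) := by
      refine (hgφ ⟨B h', h', rfl⟩).trans ?_
      simp only [φ, _root_.sum_apply, _root_.smul_apply, smul_eq_mul]
      exact Finset.sum_congr rfl fun k _ => congrArg _ (hfB k h')
    rw [← e1, hgy]
    simp only [B, inner_scaledObservation, sum_dotProduct, transpose_mulVec_dotProduct]
    exact Finset.sum_comm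
  refine ⟨∑ k, β k * Real.log ((c k ⬝ᵥ h k) / β k), ⟨fun k => β k / (c k ⬝ᵥ h k),
    fun i k j => y i (k, j) / Real.sqrt (β k), fun i => ‖y i‖, fun k => div_pos (hβ k) (hγ k),
    fun i => norm_nonneg _, hy.trans (hg.trans_le hφ), fun k => ?_, fun i => le_of_eq ?_, ?_⟩,
    h, hγ, fun i => ?_, rfl⟩
  · refine dotProduct_eq _ _ fun x => ?_
    have e := hgB (Pi.single k x)
    rw [Finset.sum_eq_single k (fun k' _ hk' => by simp [hk']) (by simp),
      Finset.sum_eq_single k (fun k' _ hk' => by simp [hk']) (by simp)] at e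
    simpa [smul_dotProduct] using e
  · rw [EuclideanSpace.norm_sq_eq, Fintype.sum_prod_type]
    refine Finset.sum_congr rfl fun k _ => ?_
    have := (hβ k).ne'
    simp only [euclNorm_sq, dotProduct, Finset.mul_sum, div_mul_div_comm,
      Real.mul_self_sqrt (hβ k).le, Real.norm_eq_abs, sq_abs]
    refine Finset.sum_congr rfl fun j _ => ?_
    field_simp
  · refine Finset.sum_congr rfl fun k _ => ?_
    rw [← mul_neg, ← Real.log_inv, inv_div]
  · rw [← norm_sq_scaledObservation A hβ]
    exact pow_le_one₀ (norm_nonneg _) ((norm_le_pi_norm (B h) i).trans hz1)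

/-- The weights of an optimal point of the primal program form an `S_β`-optimal design. -/
theorem isDesign_and_SVal_le_of_isLeast {s l m r : ℕ}
    {A : Fin r → Fin s → Matrix (Fin l) (Fin m) ℝ} {c : Fin r → Fin m → ℝ} {β : Fin r → ℝ}
    (hβ : ∀ k, 0 < β k) (hβ1 : ∑ k, β k = 1) (hc : ∀ k, c k ≠ 0)
    {t : Fin r → ℝ} {v : Fin s → Fin r → Fin l → ℝ} {w : Fin s → ℝ}
    (ht : ∀ k, 0 < t k) (hw : ∀ i, 0 ≤ w i) (hw1 : ∑ i, w i ≤ 1)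
    (htc : ∀ k, t k • c k = ∑ i, (A k i)ᵀ *ᵥ v i k)
    (hv : ∀ i, ∑ k, β k * euclNorm (v i k) ^ 2 ≤ w i ^ 2)
    (hmin : IsLeast (PβVals A c β) (∑ k, -(β k * Real.log (t k)))) :
    IsDesign w ∧ FeasibleS A c w ∧
      ∀ x ∈ SVal A c β w, x = 2 * ∑ k, -(β k * Real.log (t k)) := by
  obtain ⟨hfeas, hle⟩ := feasibleS_and_SVal_le hβ hβ1 hc ht hw htc hv
  have hge : ∀ w', IsDesign w' → ∀ x ∈ SVal A c β w',
      2 * ∑ k, -(β k * Real.log (t k)) ≤ x := fun w' hw' x hx => by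
    have := hmin.2 (half_mem_PβVals_of_mem_SVal hβ hβ1 hc hw' hx)
    linarith
  have hne : (Finset.univ : Finset (Fin r)).Nonempty := by
    by_contra h
    simp [Finset.not_nonempty_iff_eq_empty.1 h] at hβ1
  choose u hu using hfeas
  have hρ : ∀ k, 0 < c k ⬝ᵥ u k := fun k =>
    dotProduct_pos_of_infoMatK_mulVec_eq hw (hc k) (hu k)
  have hW0 : 0 < ∑ i, w i := by
    refine (Finset.sum_nonneg fun i _ => hw i).lt_of_ne fun h0 => ?_
    have hz := (Finset.sum_eq_zero_iff_of_nonneg fun i _ => hw i).1 h0.symm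
    obtain ⟨k, -⟩ := hne
    exact hc k (by rw [← hu k, mulVec_infoMatK]; simp [hz])
  set W := ∑ i, w i with hW
  have hscaled : ∑ k, β k * Real.log (c k ⬝ᵥ u k) + Real.log W ∈
      SVal A c β (fun i => w i / W) := by
    refine ⟨fun k => W • u k, fun k => ?_, ?_⟩
    · rw [← hu k, mulVec_infoMatK, mulVec_infoMatK]
      refine Finset.sum_congr rfl fun i _ => ?_
      rw [mulVec_smul, mulVec_smul, smul_smul, div_mul_cancel₀ _ hW0.ne']
    · simp only [dotProduct_smul, smul_eq_mul, Real.log_mul hW0.ne' (hρ _).ne', mul_add,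
        Finset.sum_add_distrib, ← Finset.sum_mul, hβ1, one_mul]
      ring
  have h1 := hge _ ⟨fun i => div_nonneg (hw i) hW0.le, by
    rw [← Finset.sum_div, ← hW, div_self hW0.ne']⟩ _ hscaled
  have h2 := hle _ ⟨u, hu, rfl⟩
  have hW1 : W = 1 := by
    refine le_antisymm hw1 ?_
    by_contra hlt
    have := Real.log_neg hW0 (not_le.1 hlt)
    linarith
  refine ⟨⟨hw, hW1⟩, fun k => ⟨u k, hu k⟩, fun x hx => le_antisymm ?_ (hge w ⟨hw, hW1⟩ x hx)⟩
  simpa [hW1] using hle x hx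

/-- **`S_β`-optimal designs by geometric programming.** The minimum of `S_β` over feasible
designs equals twice the infimum of the primal geometric program `(P_β)` and twice the
supremum of its dual `(D_β)`; moreover any `(t, v, w)` attaining the infimum in `(P_β)`
has `w` minimizing `S_β` over feasible designs. -/
theorem sOptimal_geometric_program {s l m r : ℕ}
    (A : Fin r → Fin s → Matrix (Fin l) (Fin m) ℝ)
    (c : Fin r → Fin m → ℝ) (β : Fin r → ℝ)
    (hβ : ∀ k, 0 < β k) (hβ1 : ∑ k, β k = 1)
    (hc : ∀ k, c k ≠ 0)
    (hrange : ∀ k, ∃ u, (∑ i, (A k i)ᵀ * A k i) *ᵥ u = c k) :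
    (∃ (w₀ : Fin s → ℝ) (v₀ : ℝ), IsDesign w₀ ∧ FeasibleS A c w₀ ∧
      v₀ ∈ SVal A c β w₀ ∧
      (∀ (w : Fin s → ℝ) (v : ℝ), IsDesign w → FeasibleS A c w →
        v ∈ SVal A c β w → v₀ ≤ v) ∧
      v₀ = 2 * sInf (PβVals A c β) ∧
      v₀ = 2 * sSup (DβVals A c β)) ∧
    (∀ (t : Fin r → ℝ) (v : Fin s → Fin r → Fin l → ℝ) (w : Fin s → ℝ),
      (∀ k, 0 < t k) → (∀ i, 0 ≤ w i) → (∑ i, w i ≤ 1) →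
      (∀ k, t k • c k = ∑ i, (A k i)ᵀ *ᵥ v i k) →
      (∀ i, ∑ k, β k * euclNorm (v i k) ^ 2 ≤ w i ^ 2) →
      (∑ k, -(β k * Real.log (t k))) = sInf (PβVals A c β) →
      IsDesign w ∧ FeasibleS A c w ∧
        (∀ (x : ℝ), x ∈ SVal A c β w →
          ∀ (w' : Fin s → ℝ) (x' : ℝ), IsDesign w' → FeasibleS A c w' →
            x' ∈ SVal A c β w' → x ≤ x')) := by
  obtain ⟨p, hpP, hpD⟩ := exists_mem_PβVals_mem_DβVals hβ hβ1 hc hrange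
  have hleast : IsLeast (PβVals A c β) p :=
    ⟨hpP, fun x hx => le_of_mem_DβVals_of_mem_PβVals hβ hβ1 hpD hx⟩
  have hgreatest : IsGreatest (DβVals A c β) p :=
    ⟨hpD, fun y hy => le_of_mem_DβVals_of_mem_PβVals hβ hβ1 hy hpP⟩
  have hge : ∀ w, IsDesign w → ∀ x ∈ SVal A c β w, 2 * p ≤ x := fun w hw x hx => by
    have := hleast.2 (half_mem_PβVals_of_mem_SVal hβ hβ1 hc hw hx)
    linarith
  rw [hleast.csInf_eq, hgreatest.csSup_eq]
  constructor
  · obtain ⟨t, v, w, ht, hw, hw1, htc, hv, rfl⟩ := hpP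
    obtain ⟨hdes, hfeas, hval⟩ :=
      isDesign_and_SVal_le_of_isLeast hβ hβ1 hc ht hw hw1 htc hv hleast
    choose u hu using hfeas
    have hx := hval _ ⟨u, hu, rfl⟩
    exact ⟨w, _, hdes, fun k => ⟨u k, hu k⟩, ⟨u, hu, hx.symm⟩,
      fun w' x' hw' _ hx' => hge w' hw' x' hx', rfl, rfl⟩
  · rintro t v w ht hw hw1 htc hv rfl
    obtain ⟨hdes, hfeas, hval⟩ :=
      isDesign_and_SVal_le_of_isLeast hβ hβ1 hc ht hw hw1 htc hv hleast
    exact ⟨hdes, hfeas, fun x hx w' x' hw' _ hx' => (hval x hx).trans_le (hge w' hw' x' hx')⟩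
end
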